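/- arXiv:2501.03942 — 2 statements merged into one kernel-verified Lean document; each statement's English description precedes it below -/
import Mathlib

section
/- Let Q be an integral quantale, i.e. a complete lattice equipped with a monoid structure (∘, 1) such that multiplication preserves arbitrary suprema in each variable and such that 1 = ⊤, and suppose Q satisfies the identity (a ∘ b) ⊓ c = ((a ⊓ c) ∘ b) ⊔ (a ∘ (b ⊓ c)) for all a, b, c ∈ Q. Then every square in Q is idempotent: for every a ∈ Q, a ∘ a = a ∘ a ∘ a. -/
/-- In an integral quantale (`1 = ⊤`) satisfying the identity
`(a ∘ b) ⊓ c = ((a ⊓ c) ∘ b) ⊔ (a ∘ (b ⊓ c))`, every square is idempotent: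
`a ∘ a = a ∘ a ∘ a` for all `a`. -/
theorem integral_quantale_squares_idempotent {Q : Type*} [CompleteLattice Q] [Monoid Q]
    (hsup_left : ∀ (a : Q) (s : Set Q), a * sSup s = ⨆ b ∈ s, a * b)
    (hsup_right : ∀ (a : Q) (s : Set Q), sSup s * a = ⨆ b ∈ s, b * a)
    (hintegral : (1 : Q) = ⊤)
    (hcond : ∀ a b c : Q, (a * b) ⊓ c = ((a ⊓ c) * b) ⊔ (a * (b ⊓ c))) :
    ∀ a : Q, a * a = a * a * a := by
  intro a
  have hle : a * a ≤ a := by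
    have h := hsup_left a {a, 1}
    have htop : sSup {a, (1 : Q)} = 1 := by rw [sSup_pair, hintegral, sup_top_eq]
    rw [htop, iSup_pair, mul_one] at h
    exact le_sup_left.trans h.ge
  have h := hcond a a (a * a)
  rwa [inf_idem, inf_eq_right.mpr hle, ← mul_assoc, sup_idem] at h
end

section
/- The operation f : [0,1] × [0,1] → [0,1] defined by f(x, y) = 0 if x ≤ 1/2 and y ≤ 1/2, and f(x, y) = min(x, y) otherwise, satisfies the identity f(a, b) ⊓ c = f(a ⊓ c, b) ⊔ f(a, b ⊓ c) for all a, b, c ∈ [0,1], where ⊓ and ⊔ denote minimum and maximum in the natural order of [0,1]. -/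
/-- The left-continuous t-norm `f x y = 0` if `x ≤ 1/2` and `y ≤ 1/2`, and
`f x y = min x y` otherwise, satisfies the identity
`f a b ⊓ c = f (a ⊓ c) b ⊔ f a (b ⊓ c)` for all `a, b, c ∈ [0,1]`. -/
theorem nilpotent_minimum_satisfies_condition :
    let f : ℝ → ℝ → ℝ := fun x y => if x ≤ 1/2 ∧ y ≤ 1/2 then 0 else min x y
    ∀ a ∈ Set.Icc (0:ℝ) 1, ∀ b ∈ Set.Icc (0:ℝ) 1, ∀ c ∈ Set.Icc (0:ℝ) 1,
      min (f a b) c = max (f (min a c) b) (f a (min b c)) := by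
  intro f a ⟨ha, _⟩ b ⟨hb, _⟩ c ⟨hc, _⟩
  simp only [f]
  grind
end
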